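/- Let k ≥ 5 be an integer. Let α_k be the cyclic permutation of P_k with α_k(1) = 3, α_k(3) = 2, α_k(2) = 5, α_k(i) = i+1 for 5 ≤ i ≤ k−1, α_k(k) = 4, and α_k(4) = 1 (the cycle 1→3→2→5→6→⋯→k→4→1), and let θ_k be the cyclic permutation of P_k with θ_k(1) = k, θ_k(i) = i−1 for 6 ≤ i ≤ k, θ_k(5) = 2, θ_k(2) = 3, θ_k(3) = 4, and θ_k(4) = 1 (the cycle 1→k→k−1→⋯→6→5→2→3→4→1). Then α_k and θ_k are right similar, but neither left similar nor two-sided similar; moreover the Petrie matrices M_{α_k} and M_{θ_k} are similar over ℝ if k = 5 and are not similar if k > 5. -/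

import Mathlib

open Matrix

/-- `σ` is a permutation of `P_n = {1,…,n}`, viewed as a function `ℕ → ℕ`. -/
def IsPermOn (n : ℕ) (σ : ℕ → ℕ) : Prop :=
  Set.BijOn σ (Set.Icc 1 n) (Set.Icc 1 n)

/-- The Petrie matrix of a map `σ` on `P_n`: the `(n-1) × (n-1)` real matrix whose
`(i,j)` entry (with `1`-based indices) is `1` iff
`min (σ i) (σ (i+1)) ≤ j ≤ max (σ i) (σ (i+1)) - 1`, and `0` otherwise. -/
def petrie (n : ℕ) (σ : ℕ → ℕ) : Matrix (Fin (n - 1)) (Fin (n - 1)) ℝ :=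
  Matrix.of fun i j =>
    if min (σ (i.1 + 1)) (σ (i.1 + 2)) ≤ j.1 + 1 ∧
        j.1 + 1 ≤ max (σ (i.1 + 1)) (σ (i.1 + 2)) - 1 then 1 else 0

/-- Two square real matrices are similar if `B = P * A * P⁻¹` for some invertible `P`. -/
def MatSimilar {m : Type*} [Fintype m] [DecidableEq m] (A B : Matrix m m ℝ) : Prop :=
  ∃ P : Matrix m m ℝ, IsUnit P ∧ B = P * A * P⁻¹

/-- `σ'` (a permutation of `P_{k+n}`) is a right extension of `σ` (a permutation of `P_k`). -/
def IsRightExt (k n : ℕ) (σ σ' : ℕ → ℕ) : Prop :=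
  IsPermOn (k + n) σ' ∧
  (∀ i, 1 ≤ i → i ≤ k - 1 → σ' i = σ i) ∧
  ∃ t, k + 1 ≤ t ∧ t ≤ k + n ∧ σ' t = σ k ∧
    ∀ j, j ≠ t → k ≤ j → j ≤ k + n → k < σ' j

/-- `(σ', ρ')` is a synchronized right extension of `(σ, ρ)` to `P_{k+n}`. -/
def IsSyncRightExt (k n : ℕ) (σ ρ σ' ρ' : ℕ → ℕ) : Prop :=
  IsRightExt k n σ σ' ∧ IsRightExt k n ρ ρ' ∧
  ∃ t, k + 1 ≤ t ∧ t ≤ k + n ∧ σ' t = σ k ∧ ρ' t = ρ k ∧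
    ∀ i, i ≠ t → k ≤ i → i ≤ k + n → σ' i = ρ' i

/-- `σ'` (a permutation of `P_{m+k}`) is a left extension of `σ` (a permutation of `P_k`). -/
def IsLeftExt (k m : ℕ) (σ σ' : ℕ → ℕ) : Prop :=
  IsPermOn (m + k) σ' ∧
  (∀ i, 2 ≤ i → i ≤ k → σ' (m + i) = m + σ i) ∧
  ∃ s, 1 ≤ s ∧ s ≤ m ∧ σ' s = m + σ 1 ∧
    ∀ j, j ≠ s → 1 ≤ j → j ≤ m + 1 → σ' j < m + 1

/-- `(σ', ρ')` is a synchronized left extension of `(σ, ρ)` to `P_{m+k}`. -/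
def IsSyncLeftExt (k m : ℕ) (σ ρ σ' ρ' : ℕ → ℕ) : Prop :=
  IsLeftExt k m σ σ' ∧ IsLeftExt k m ρ ρ' ∧
  ∃ s, 1 ≤ s ∧ s ≤ m ∧ σ' s = m + σ 1 ∧ ρ' s = m + ρ 1 ∧
    ∀ i, i ≠ s → 1 ≤ i → i ≤ m + 1 → σ' i = ρ' i

/-- `σ'` (a permutation of `P_{m+k+n}`) is a two-sided extension of `σ` (a permutation of `P_k`). -/
def IsTwoSidedExt (k m n : ℕ) (σ σ' : ℕ → ℕ) : Prop :=
  IsPermOn (m + k + n) σ' ∧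
  (∀ i, 2 ≤ i → i ≤ k - 1 → σ' (m + i) = m + σ i) ∧
  (∃ s, 1 ≤ s ∧ s ≤ m ∧ σ' s = m + σ 1 ∧
    ∀ i, i ≠ s → 1 ≤ i → i ≤ m + 1 → σ' i < m + 1) ∧
  (∃ t, m + k + 1 ≤ t ∧ t ≤ m + k + n ∧ σ' t = m + σ k ∧
    ∀ j, j ≠ t → m + k ≤ j → j ≤ m + k + n → m + k < σ' j)

/-- `(σ', ρ')` is a synchronized two-sided extension of `(σ, ρ)` to `P_{m+k+n}`. -/
def IsSyncTwoSidedExt (k m n : ℕ) (σ ρ σ' ρ' : ℕ → ℕ) : Prop :=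
  IsTwoSidedExt k m n σ σ' ∧ IsTwoSidedExt k m n ρ ρ' ∧
  ∃ s t, 1 ≤ s ∧ s ≤ m ∧ m + k + 1 ≤ t ∧ t ≤ m + k + n ∧
    σ' s = m + σ 1 ∧ ρ' s = m + ρ 1 ∧ σ' t = m + σ k ∧ ρ' t = m + ρ k ∧
    ∀ i, i ≠ s → i ≠ t →
      ((1 ≤ i ∧ i ≤ m + 1) ∨ (m + k ≤ i ∧ i ≤ m + k + n)) → σ' i = ρ' i

/-- `σ` and `ρ` (permutations of `P_k`) are right similar. -/
def RightSimilar (k : ℕ) (σ ρ : ℕ → ℕ) : Prop :=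
  ∀ n, 1 ≤ n → ∀ σ' ρ' : ℕ → ℕ, IsSyncRightExt k n σ ρ σ' ρ' →
    MatSimilar (petrie (k + n) σ') (petrie (k + n) ρ')

/-- `σ` and `ρ` (permutations of `P_k`) are left similar. -/
def LeftSimilar (k : ℕ) (σ ρ : ℕ → ℕ) : Prop :=
  ∀ m, 1 ≤ m → ∀ σ' ρ' : ℕ → ℕ, IsSyncLeftExt k m σ ρ σ' ρ' →
    MatSimilar (petrie (m + k) σ') (petrie (m + k) ρ')

/-- `σ` and `ρ` (permutations of `P_k`) are two-sided similar. -/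
def TwoSidedSimilar (k : ℕ) (σ ρ : ℕ → ℕ) : Prop :=
  ∀ m n, 1 ≤ m → 1 ≤ n → ∀ σ' ρ' : ℕ → ℕ, IsSyncTwoSidedExt k m n σ ρ σ' ρ' →
    MatSimilar (petrie (m + k + n) σ') (petrie (m + k + n) ρ')

/-- `σ` and `ρ` (permutations of `P_k`) are right weakly similar. -/
def RightWeaklySimilar (k : ℕ) (σ ρ : ℕ → ℕ) : Prop :=
  ∀ n, 1 ≤ n → ∀ σ' ρ' : ℕ → ℕ, IsSyncRightExt k n σ ρ σ' ρ' →
    (petrie (k + n) σ').charpoly = (petrie (k + n) ρ').charpoly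

/-- The cyclic permutation `α_k : 1→3→2→5→6→⋯→k→4→1` of `P_k` (`k ≥ 5`). -/
def alphaK (k : ℕ) : ℕ → ℕ := fun i =>
  if i = 1 then 3
  else if i = 3 then 2
  else if i = 2 then 5
  else if 5 ≤ i ∧ i ≤ k - 1 then i + 1
  else if i = k then 4
  else if i = 4 then 1
  else i

/-- The cyclic permutation `θ_k : 1→k→k-1→⋯→6→5→2→3→4→1` of `P_k` (`k ≥ 5`). -/
def thetaK (k : ℕ) : ℕ → ℕ := fun i =>
  if i = 1 then k
  else if 6 ≤ i ∧ i ≤ k then i - 1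
  else if i = 5 then 2
  else if i = 2 then 3
  else if i = 3 then 4
  else if i = 4 then 1
  else i

theorem matSimilar_of {m : Type*} [Fintype m] [DecidableEq m] {A B P : Matrix m m ℝ}
    (hP : IsUnit P) (h : P * A = B * P) : MatSimilar A B := by
  refine ⟨P, hP, ?_⟩
  rw [h, Matrix.mul_assoc, Matrix.mul_nonsing_inv _ ((Matrix.isUnit_iff_isUnit_det _).1 hP),
    Matrix.mul_one]

theorem MatSimilar.trace_eq {m : Type*} [Fintype m] [DecidableEq m] {A B : Matrix m m ℝ}
    (h : MatSimilar A B) : A.trace = B.trace := by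
  obtain ⟨P, hP, rfl⟩ := h
  rw [Matrix.trace_mul_comm, ← Matrix.mul_assoc,
    Matrix.nonsing_inv_mul _ ((Matrix.isUnit_iff_isUnit_det _).1 hP), Matrix.one_mul]

theorem MatSimilar.trace_sq_eq {m : Type*} [Fintype m] [DecidableEq m] {A B : Matrix m m ℝ}
    (h : MatSimilar A B) : (A * A).trace = (B * B).trace := by
  apply MatSimilar.trace_eq
  obtain ⟨P, hP, rfl⟩ := h
  refine matSimilar_of hP ?_
  have hi := Matrix.nonsing_inv_mul _ ((Matrix.isUnit_iff_isUnit_det _).1 hP)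
  calc P * (A * A) = P * A * (1 : Matrix m m ℝ) * A * 1 := by simp [Matrix.mul_assoc]
    _ = P * A * P⁻¹ * (P * A * P⁻¹) * P := by rw [← hi]; simp only [Matrix.mul_assoc]

/-- change the value at `k` to `k`. -/
def hatK (k : ℕ) (σ : ℕ → ℕ) : ℕ → ℕ := fun i => if i = k then k else σ i

/-- The block splitting of the index set. -/
def splitE (k n : ℕ) (hk : 1 ≤ k) : Fin (k - 1) ⊕ Fin n ≃ Fin (k + n - 1) :=
  finSumFinEquiv.trans (finCongr (by omega))

theorem splitE_inl (k n : ℕ) (hk : 1 ≤ k) (i : Fin (k - 1)) :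
    (splitE k n hk (Sum.inl i)).1 = i.1 := by
  simp [splitE]

theorem splitE_inr (k n : ℕ) (hk : 1 ≤ k) (i : Fin n) :
    (splitE k n hk (Sum.inr i)).1 = k - 1 + i.1 := by
  simp [splitE]

theorem block_form (k n : ℕ) (hk : 3 ≤ k) (σ σ' : ℕ → ℕ) (t : ℕ)
    (hb : ∀ i, 1 ≤ i → i ≤ k → 1 ≤ σ i ∧ σ i ≤ k) (hl : σ k < k)
    (ht : k + 1 ≤ t) (ht' : t ≤ k + n)
    (h1 : ∀ i, 1 ≤ i → i ≤ k - 1 → σ' i = σ i) (h2 : σ' t = σ k)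
    (h3 : ∀ j, j ≠ t → k ≤ j → j ≤ k + n → k < σ' j) :
    (petrie (k + n) σ').submatrix (splitE k n (by omega)) (splitE k n (by omega)) =
      Matrix.fromBlocks (petrie k (hatK k σ))
        (Matrix.of fun i j => if i.1 + 2 = k ∧ k + j.1 < σ' k then 1 else 0)
        (Matrix.of fun i j => if (k + i.1 = t ∨ k + i.1 + 1 = t) ∧ σ k ≤ j.1 + 1 then 1 else 0)
        (Matrix.of fun i j => if (if k + i.1 = t ∨ k + i.1 + 1 = t then
            k + j.1 + 1 ≤ (if k + i.1 = t then σ' (k + i.1 + 1) else σ' (k + i.1))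
          else min (σ' (k + i.1)) (σ' (k + i.1 + 1)) ≤ k + j.1 ∧
            k + j.1 ≤ max (σ' (k + i.1)) (σ' (k + i.1 + 1)) - 1) then 1 else 0) := by
  ext i j
  have hkk := h3 k (by omega) (by omega) (by omega)
  rcases i with i | i <;> rcases j with j | j <;>
    simp only [Matrix.submatrix_apply, Matrix.fromBlocks_apply₁₁, Matrix.fromBlocks_apply₁₂,
      Matrix.fromBlocks_apply₂₁, Matrix.fromBlocks_apply₂₂, petrie, Matrix.of_apply,
      splitE_inl, splitE_inr]
  · have hi := i.2
    have hj := j.2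
    have e1 := h1 (i.1 + 1) (by omega) (by omega)
    have b1 := hb (i.1 + 1) (by omega) (by omega)
    have e3 : hatK k σ (i.1 + 1) = σ (i.1 + 1) := by simp only [hatK]; rw [if_neg (by omega)]
    rw [e1, e3]
    by_cases h : i.1 + 2 = k
    · have e4 : hatK k σ (i.1 + 2) = k := by simp [hatK, h]
      rw [e4, h]
      congr 1
      apply propext
      omega
    · have e4 : hatK k σ (i.1 + 2) = σ (i.1 + 2) := by simp [hatK, h]
      rw [e4, h1 (i.1 + 2) (by omega) (by omega)]
  · have hi := i.2
    have hj := j.2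
    have e1 := h1 (i.1 + 1) (by omega) (by omega)
    have b1 := hb (i.1 + 1) (by omega) (by omega)
    rw [e1]
    congr 1
    apply propext
    by_cases h : i.1 + 2 = k
    · rw [h]; omega
    · have b2 := hb (i.1 + 2) (by omega) (by omega)
      rw [h1 (i.1 + 2) (by omega) (by omega)]
      omega
  · have hi := i.2
    have hj := j.2
    have q1 : k - 1 + i.1 + 1 = k + i.1 := by omega
    have q2 : k - 1 + i.1 + 2 = k + i.1 + 1 := by omega
    rw [q1, q2]
    congr 1
    apply propext
    have b := hb k (by omega) le_rfl
    by_cases c1 : k + i.1 = t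
    · have := h3 (k + i.1 + 1)
      rcases Nat.lt_or_ge (k + i.1) (k + n) with hh | hh
      · have := h3 (k + i.1 + 1) (by omega) (by omega) (by omega)
        rw [c1] at this ⊢
        rw [h2]; omega
      · omega
    · have a1 := h3 (k + i.1) (by omega) (by omega) (by omega)
      by_cases c2 : k + i.1 + 1 = t
      · rw [c2, h2]; omega
      · have a2 := h3 (k + i.1 + 1) (by omega) (by omega) (by omega)
        omega
  · have hi := i.2
    have hj := j.2
    have q1 : k - 1 + i.1 + 1 = k + i.1 := by omega
    have q2 : k - 1 + i.1 + 2 = k + i.1 + 1 := by omega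
    have q3 : k - 1 + j.1 + 1 = k + j.1 := by omega
    rw [q1, q2, q3]
    congr 1
    apply propext
    have b := hb k (by omega) le_rfl
    by_cases c1 : k + i.1 = t
    · have := h3 (k + i.1 + 1) (by omega) (by omega) (by omega)
      rw [if_pos (Or.inl c1), if_pos c1]
      rw [c1] at this ⊢
      rw [h2]; omega
    · have a1 := h3 (k + i.1) (by omega) (by omega) (by omega)
      by_cases c2 : k + i.1 + 1 = t
      · rw [if_pos (Or.inr c2), if_neg c1, c2, h2]; omega
      · rw [if_neg (by omega)]

theorem right_of_Q (k : ℕ) (hk : 3 ≤ k) (σ ρ : ℕ → ℕ)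
    (hσ : ∀ i, 1 ≤ i → i ≤ k → 1 ≤ σ i ∧ σ i ≤ k) (hσl : σ k < k)
    (hρ : ∀ i, 1 ≤ i → i ≤ k → 1 ≤ ρ i ∧ ρ i ≤ k) (hρl : ρ k < k)
    (Q : Matrix (Fin (k - 1)) (Fin (k - 1)) ℝ) (hQ : IsUnit Q)
    (h1 : Q * petrie k (hatK k σ) = petrie k (hatK k ρ) * Q)
    (h2 : ∀ i j : Fin (k - 1), j.1 + 2 = k → Q i j = if i.1 + 2 = k then 1 else 0)
    (h3 : ∀ j : Fin (k - 1), ∑ i : Fin (k - 1), (if ρ k ≤ i.1 + 1 then 1 else 0) * Q i j =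
      if σ k ≤ j.1 + 1 then 1 else 0) : RightSimilar k σ ρ := by
  intro n hn σ' ρ' h
  obtain ⟨⟨_, a1, t1, a2, a3, a4, a5⟩, ⟨_, b1, t2, b2, b3, b4, b5⟩, t, c1, c2, c3, c4, c5⟩ := h
  have ht1 : t1 = t := by
    by_contra hne
    have := a5 t (fun h => hne h.symm) (by omega) c2
    omega
  have ht2 : t2 = t := by
    by_contra hne
    have := b5 t (fun h => hne h.symm) (by omega) c2
    omega
  subst ht1
  subst ht2
  have hA := block_form k n hk σ σ' t2 hσ hσl c1 c2 a1 c3 a5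
  have hB := block_form k n hk ρ ρ' t2 hρ hρl c1 c2 b1 c4 b5
  set e := splitE k n (by omega) with he
  have hA' : petrie (k + n) σ' = ((petrie (k + n) σ').submatrix e e).submatrix e.symm e.symm := by
    simp
  have hB' : petrie (k + n) ρ' = ((petrie (k + n) ρ').submatrix e e).submatrix e.symm e.symm := by
    simp
  have hU : IsUnit (Matrix.fromBlocks Q 0 0 (1 : Matrix (Fin n) (Fin n) ℝ)) := by
    rw [Matrix.isUnit_iff_isUnit_det] at hQ ⊢
    rw [Matrix.det_fromBlocks_zero₂₁]
    simpa using hQ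
  refine matSimilar_of
    (P := (Matrix.fromBlocks Q 0 0 (1 : Matrix (Fin n) (Fin n) ℝ)).submatrix e.symm e.symm) ?_ ?_
  · rw [Matrix.isUnit_iff_isUnit_det] at hU ⊢
    rwa [Matrix.det_submatrix_equiv_self]
  rw [hA', hB', hA, hB, Matrix.submatrix_mul_equiv, Matrix.submatrix_mul_equiv]
  congr 1
  rw [Matrix.fromBlocks_multiply, Matrix.fromBlocks_multiply]
  have hkk : σ' k = ρ' k := c5 k (by omega) le_rfl (by omega)
  congr 1
  · simpa using h1
  · ext i j
    simp only [Matrix.zero_mul, add_zero, Matrix.mul_zero, zero_add, Matrix.mul_one,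
      Matrix.mul_apply, Matrix.of_apply, hkk]
    rw [Finset.sum_eq_single (⟨k - 2, by omega⟩ : Fin (k - 1))]
    · rw [h2 i _ (by simp; omega)]
      have : k - 2 + 2 = k := by omega
      simp only [this, true_and]
      by_cases h : i.1 + 2 = k <;> simp [h]
    · intro b _ hb
      rw [if_neg, mul_zero]
      rintro ⟨h, _⟩
      apply hb
      ext
      simp; omega
    · simp
  · ext i j
    simp only [Matrix.zero_mul, zero_add, Matrix.mul_zero, add_zero, Matrix.one_mul,
      Matrix.mul_apply, Matrix.of_apply]
    by_cases h : k + i.1 = t2 ∨ k + i.1 + 1 = t2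
    · simp only [h, true_and]
      rw [h3 j]
    · simp [h]
  · ext i j
    simp only [Matrix.zero_mul, zero_add, Matrix.mul_zero, Matrix.one_mul, Matrix.mul_one,
      Matrix.of_apply]
    have hi := i.2
    congr 1
    by_cases d1 : k + i.1 = t2
    · simp only [d1, true_or, if_true]
      rw [c5 (t2 + 1) (by omega) (by omega) (by omega)]
    · rw [c5 (k + i.1) d1 (by omega) (by omega)]
      by_cases d2 : k + i.1 + 1 = t2
      · simp only [d1, d2, or_true, if_true, if_false]
      · rw [c5 (k + i.1 + 1) d2 (by omega) (by omega)]

/-- The action of the Petrie matrix of `hatK k (alphaK k)` on row vectors. -/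
def act (w : ℕ → ℝ) (c : ℕ) : ℝ :=
  if c = 1 then w 3 + w 4 else if c = 2 then w 2 + w 4 else if c ≤ 4 then w 1 + w 2 + w 4
  else w (c - 1)

def RR : ℕ → ℕ → ℝ
  | 0 => fun c => if 4 ≤ c then 1 else 0
  | j + 1 => act (RR j)

theorem RR_shift (j i : ℕ) : RR (j + i) (4 + i) = RR j 4 := by
  induction i with
  | zero => rfl
  | succ i ih =>
    rw [← ih]
    show act (RR (j + i)) (4 + (i + 1)) = _
    simp only [act]
    rw [if_neg (by omega), if_neg (by omega), if_neg (by omega)]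
    rfl

theorem RR_one (j i : ℕ) (h : j ≤ i) : RR j (4 + i) = 1 := by
  induction j generalizing i with
  | zero => simp [RR]
  | succ j ih =>
    obtain ⟨i, rfl⟩ : ∃ i', i = i' + 1 := ⟨i - 1, by omega⟩
    rw [← ih i (by omega)]
    show act (RR j) (4 + (i + 1)) = _
    simp only [act]
    rw [if_neg (by omega), if_neg (by omega), if_neg (by omega)]
    rfl

theorem RR_rec4 (j c : ℕ) (hc : 1 ≤ c) (hc' : c ≤ 4) :
    RR (j + 4) c = 2 * RR (j + 3) c + 2 * RR (j + 2) c - 2 * RR (j + 1) c := by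
  interval_cases c <;> simp [RR, act] <;> ring

theorem RR_rec (j c : ℕ) (hc : 1 ≤ c) (hc' : c ≤ 4 + j) :
    RR (j + 4) c = 2 * RR (j + 3) c + 2 * RR (j + 2) c - 2 * RR (j + 1) c := by
  by_cases h : c ≤ 4
  · exact RR_rec4 j c hc h
  · obtain ⟨i, rfl⟩ : ∃ i, c = 4 + i := ⟨c - 4, by omega⟩
    obtain ⟨j, rfl⟩ : ∃ j', j = j' + i := ⟨j - i, by omega⟩
    have e (a : ℕ) : j + i + a = j + a + i := by omega
    rw [e, e, e, e, RR_shift, RR_shift, RR_shift, RR_shift]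
    exact RR_rec4 j 4 (by omega) (by omega)

theorem act_eq (k : ℕ) (hk : 6 ≤ k) (w : ℕ → ℝ) (j : Fin (k - 1)) :
    ∑ l : Fin (k - 1), w (l.1 + 1) * petrie k (hatK k (alphaK k)) l j = act w (j.1 + 1) := by
  have pick (a : ℕ) (h1 : 1 ≤ a) (h2 : a < k) :
      ∑ l : Fin (k - 1), w (l.1 + 1) * (if l.1 + 1 = a then 1 else 0) = w a := by
    rw [Finset.sum_eq_single (⟨a - 1, by omega⟩ : Fin (k - 1))]
    · have : a - 1 + 1 = a := by omega
      simp [this]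
    · intro b _ hb
      rw [if_neg, mul_zero]
      intro h
      apply hb
      ext
      simp; omega
    · simp
  have hj := j.2
  have entry (l : Fin (k - 1)) : petrie k (hatK k (alphaK k)) l j =
      if (l.1 + 1 = 1 ∧ 3 ≤ j.1 + 1 ∧ j.1 + 1 ≤ 4) ∨ (l.1 + 1 = 2 ∧ 2 ≤ j.1 + 1 ∧ j.1 + 1 ≤ 4) ∨
        (l.1 + 1 = 3 ∧ j.1 + 1 = 1) ∨ (l.1 + 1 = 4 ∧ j.1 + 1 ≤ 5) ∨
        (5 ≤ l.1 + 1 ∧ l.1 + 1 = j.1) then 1 else 0 := by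
    have hl := l.2
    simp only [petrie, Matrix.of_apply]
    congr 1
    apply propext
    simp only [hatK, alphaK]
    split_ifs <;> omega
  simp only [entry]
  by_cases c1 : j.1 + 1 = 1
  · have : ∀ l : Fin (k - 1), w (l.1 + 1) * (if (l.1 + 1 = 1 ∧ 3 ≤ j.1 + 1 ∧ j.1 + 1 ≤ 4) ∨ (l.1 + 1 = 2 ∧ 2 ≤ j.1 + 1 ∧ j.1 + 1 ≤ 4) ∨
        (l.1 + 1 = 3 ∧ j.1 + 1 = 1) ∨ (l.1 + 1 = 4 ∧ j.1 + 1 ≤ 5) ∨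
        (5 ≤ l.1 + 1 ∧ l.1 + 1 = j.1) then 1 else 0) =
        w (l.1 + 1) * (if l.1 + 1 = 3 then 1 else 0) +
        w (l.1 + 1) * (if l.1 + 1 = 4 then 1 else 0) := by
      intro l
      split_ifs <;> first | omega | simp
    simp only [this, Finset.sum_add_distrib]
    rw [pick 3 (by omega) (by omega), pick 4 (by omega) (by omega)]
    simp [act, c1]
  by_cases c2 : j.1 + 1 = 2
  · have : ∀ l : Fin (k - 1), w (l.1 + 1) * (if (l.1 + 1 = 1 ∧ 3 ≤ j.1 + 1 ∧ j.1 + 1 ≤ 4) ∨ (l.1 + 1 = 2 ∧ 2 ≤ j.1 + 1 ∧ j.1 + 1 ≤ 4) ∨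
        (l.1 + 1 = 3 ∧ j.1 + 1 = 1) ∨ (l.1 + 1 = 4 ∧ j.1 + 1 ≤ 5) ∨
        (5 ≤ l.1 + 1 ∧ l.1 + 1 = j.1) then 1 else 0) =
        w (l.1 + 1) * (if l.1 + 1 = 2 then 1 else 0) +
        w (l.1 + 1) * (if l.1 + 1 = 4 then 1 else 0) := by
      intro l
      split_ifs <;> first | omega | simp
    simp only [this, Finset.sum_add_distrib]
    rw [pick 2 (by omega) (by omega), pick 4 (by omega) (by omega)]
    simp [act, c2]
  by_cases c3 : j.1 + 1 ≤ 4
  · have : ∀ l : Fin (k - 1), w (l.1 + 1) * (if (l.1 + 1 = 1 ∧ 3 ≤ j.1 + 1 ∧ j.1 + 1 ≤ 4) ∨ (l.1 + 1 = 2 ∧ 2 ≤ j.1 + 1 ∧ j.1 + 1 ≤ 4) ∨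
        (l.1 + 1 = 3 ∧ j.1 + 1 = 1) ∨ (l.1 + 1 = 4 ∧ j.1 + 1 ≤ 5) ∨
        (5 ≤ l.1 + 1 ∧ l.1 + 1 = j.1) then 1 else 0) =
        w (l.1 + 1) * (if l.1 + 1 = 1 then 1 else 0) +
        w (l.1 + 1) * (if l.1 + 1 = 2 then 1 else 0) +
        w (l.1 + 1) * (if l.1 + 1 = 4 then 1 else 0) := by
      intro l
      split_ifs <;> first | omega | simp
    simp only [this, Finset.sum_add_distrib]
    rw [pick 1 (by omega) (by omega), pick 2 (by omega) (by omega), pick 4 (by omega) (by omega)]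
    simp only [act, c1, c2, c3, if_true, if_false]
  · have : ∀ l : Fin (k - 1), w (l.1 + 1) * (if (l.1 + 1 = 1 ∧ 3 ≤ j.1 + 1 ∧ j.1 + 1 ≤ 4) ∨ (l.1 + 1 = 2 ∧ 2 ≤ j.1 + 1 ∧ j.1 + 1 ≤ 4) ∨
        (l.1 + 1 = 3 ∧ j.1 + 1 = 1) ∨ (l.1 + 1 = 4 ∧ j.1 + 1 ≤ 5) ∨
        (5 ≤ l.1 + 1 ∧ l.1 + 1 = j.1) then 1 else 0) =
        w (l.1 + 1) * (if l.1 + 1 = j.1 then 1 else 0) := by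
      intro l
      split_ifs <;> first | omega | simp
    simp only [this]
    rw [pick j.1 (by omega) (by omega)]
    simp only [act, c1, c2, c3, if_false]
    rfl

theorem telescope (k : ℕ) (G : ℕ → ℝ) (a b : ℕ) (ha : 1 ≤ a) (hab : a ≤ b) (hb : b ≤ k) :
    ∑ l : Fin (k - 1), (if a ≤ l.1 + 1 ∧ l.1 + 1 ≤ b - 1 then 1 else 0) *
      (G (l.1 + 1) - G (l.1 + 2)) = G a - G b := by
  rw [Fin.sum_univ_eq_sum_range (fun l => (if a ≤ l + 1 ∧ l + 1 ≤ b - 1 then (1 : ℝ) else 0) *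
      (G (l + 1) - G (l + 2))) (k - 1)]
  simp only [ite_mul, one_mul, zero_mul]
  rw [← Finset.sum_filter]
  have : (Finset.range (k - 1)).filter (fun l => a ≤ l + 1 ∧ l + 1 ≤ b - 1) =
      Finset.Ico (a - 1) (b - 1) := by
    ext l; simp; omega
  rw [this]
  have h := Finset.sum_Ico_sub (fun l => G (l + 1)) (show a - 1 ≤ b - 1 by omega)
  have e1 : a - 1 + 1 = a := by omega
  have e2 : b - 1 + 1 = b := by omega
  rw [e1, e2] at h
  rw [← neg_sub (G b), ← h, ← Finset.sum_neg_distrib]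
  apply Finset.sum_congr rfl
  intros; ring

/-- Partial sums of the rows of the intertwiner. -/
def FF (k i c : ℕ) : ℝ :=
  if k ≤ i then 0
  else if 5 ≤ i then RR (k - 1 - i) c
  else if i = 4 then -12 * RR (k - 4) c - 5 * RR (k - 3) c + 4 * RR (k - 2) c
  else if i = 3 then -7 * RR (k - 4) c - 2 * RR (k - 3) c + 2 * RR (k - 2) c
  else if i = 2 then RR (k - 5) c
  else -8 * RR (k - 4) c - 4 * RR (k - 3) c + 3 * RR (k - 2) c

theorem act_lin (a b c d : ℝ) (u v w x : ℕ → ℝ) (j : ℕ) :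
    act (fun i => a * u i + b * v i + c * w i + d * x i) j =
      a * act u j + b * act v j + c * act w j + d * act x j := by
  simp only [act]; split_ifs <;> ring

/-- The intertwiner. -/
def QQ (k : ℕ) : Matrix (Fin (k - 1)) (Fin (k - 1)) ℝ :=
  Matrix.of fun i j => FF k (i.1 + 1) (j.1 + 1) - FF k (i.1 + 2) (j.1 + 1)

theorem QQ_last (k : ℕ) (hk : 6 ≤ k) (i j : Fin (k - 1)) (hj : j.1 + 2 = k) :
    QQ k i j = if i.1 + 2 = k then 1 else 0 := by
  have hj' : j.1 + 1 = k - 1 := by omega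
  have hF (i : ℕ) (hi : i < k) : FF k i (k - 1) = 1 := by
    have e : k - 1 = 4 + (k - 5) := by omega
    have f (a : ℕ) (ha : a ≤ 3) : RR (k - 5 + a) (k - 1) = RR a 4 := by
      rw [← RR_shift a (k - 5), e]
      congr 1
      omega
    have f1 : RR (k - 4) (k - 1) = 1 := by
      rw [show k - 4 = k - 5 + 1 by omega, f 1 (by omega)]; simp [RR, act]
    have f2 : RR (k - 3) (k - 1) = 3 := by
      rw [show k - 3 = k - 5 + 2 by omega, f 2 (by omega)]; simp [RR, act]; norm_num
    have f3 : RR (k - 2) (k - 1) = 7 := by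
      rw [show k - 2 = k - 5 + 3 by omega, f 3 (by omega)]; simp [RR, act]; norm_num
    have f0 : RR (k - 5) (k - 1) = 1 := by
      rw [e]; exact RR_one _ _ le_rfl
    simp only [FF]
    split_ifs
    · omega
    · rw [e]; exact RR_one _ _ (by omega)
    all_goals first | (rw [f1, f2, f3]; norm_num) | exact f0
  simp only [QQ, Matrix.of_apply, hj']
  have hi := i.2
  rw [hF _ (by omega)]
  split_ifs with h
  · simp [FF, h]
  · rw [hF _ (by omega)]; simp

theorem QQ_b (k : ℕ) (hk : 6 ≤ k) (j : Fin (k - 1)) :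
    ∑ i : Fin (k - 1), (if thetaK k k ≤ i.1 + 1 then 1 else 0) * QQ k i j =
      if alphaK k k ≤ j.1 + 1 then 1 else 0 := by
  have e1 : thetaK k k = k - 1 := by simp only [thetaK]; split_ifs <;> omega
  have e2 : alphaK k k = 4 := by simp only [alphaK]; split_ifs <;> omega
  rw [e1, e2]
  have h := telescope k (fun i => FF k i (j.1 + 1)) (k - 1) k (by omega) (by omega) le_rfl
  have e : FF k (k - 1) (j.1 + 1) - FF k k (j.1 + 1) = if 4 ≤ j.1 + 1 then 1 else 0 := by
    simp only [FF]
    rw [if_neg (by omega), if_pos (by omega), if_pos (by omega),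
      show k - 1 - (k - 1) = 0 by omega]
    simp [RR]
  rw [← e, ← h]
  apply Finset.sum_congr rfl
  intro i _
  have hi := i.2
  simp only [QQ, Matrix.of_apply]
  congr 2
  apply propext
  omega

set_option maxHeartbeats 4000000 in
theorem QQ_inter (k : ℕ) (hk : 6 ≤ k) :
    QQ k * petrie k (hatK k (alphaK k)) = petrie k (hatK k (thetaK k)) * QQ k := by
  ext i j
  rw [Matrix.mul_apply, Matrix.mul_apply]
  have hi := i.2
  have hj := j.2
  have h1 := act_eq k hk (fun c => FF k (i.1 + 1) c - FF k (i.1 + 2) c) j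
  have hb (i : ℕ) (hi : 1 ≤ i) (hi' : i ≤ k) :
      1 ≤ hatK k (thetaK k) i ∧ hatK k (thetaK k) i ≤ k := by
    simp only [hatK, thetaK]; split_ifs <;> omega
  have hb1 := hb (i.1 + 1) (by omega) (by omega)
  have hb2 := hb (i.1 + 2) (by omega) (by omega)
  have h2 := telescope k (fun i => FF k i (j.1 + 1))
    (min (hatK k (thetaK k) (i.1 + 1)) (hatK k (thetaK k) (i.1 + 2)))
    (max (hatK k (thetaK k) (i.1 + 1)) (hatK k (thetaK k) (i.1 + 2)))
    (by omega) (by omega) (by omega)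
  simp only [QQ, petrie, Matrix.of_apply] at h1 h2 ⊢
  rw [h1, h2]
  have hact (n : ℕ) : act (RR n) (j.1 + 1) = RR (n + 1) (j.1 + 1) := rfl
  have hrec : RR (k - 1) (j.1 + 1) = 2 * RR (k - 2) (j.1 + 1) + 2 * RR (k - 3) (j.1 + 1)
      - 2 * RR (k - 4) (j.1 + 1) := by
    have := RR_rec (k - 5) (j.1 + 1) (by omega) (by omega)
    rw [show k - 5 + 4 = k - 1 by omega, show k - 5 + 3 = k - 2 by omega,
      show k - 5 + 2 = k - 3 by omega, show k - 5 + 1 = k - 4 by omega] at this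
    exact this
  have F1 (c : ℕ) : FF k 1 c = -8 * RR (k - 4) c - 4 * RR (k - 3) c + 3 * RR (k - 2) c := by
    simp only [FF]; split_ifs <;> first | omega | rfl
  have F2 (c : ℕ) : FF k 2 c = RR (k - 5) c := by
    simp only [FF]; split_ifs <;> first | omega | rfl
  have F3 (c : ℕ) : FF k 3 c = -7 * RR (k - 4) c - 2 * RR (k - 3) c + 2 * RR (k - 2) c := by
    simp only [FF]; split_ifs <;> first | omega | rfl
  have F4 (c : ℕ) : FF k 4 c = -12 * RR (k - 4) c - 5 * RR (k - 3) c + 4 * RR (k - 2) c := by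
    simp only [FF]; split_ifs <;> first | omega | rfl
  have F5 (i c : ℕ) (h : 5 ≤ i) (h' : i < k) : FF k i c = RR (k - 1 - i) c := by
    simp only [FF]; split_ifs <;> first | omega | rfl
  have Fk (c : ℕ) : FF k k c = 0 := by simp [FF]
  have a5 := hact (k - 5)
  have a4 := hact (k - 4)
  have a3 := hact (k - 3)
  have a2 := hact (k - 2)
  rw [show k - 5 + 1 = k - 4 by omega] at a5
  rw [show k - 4 + 1 = k - 3 by omega] at a4
  rw [show k - 3 + 1 = k - 2 by omega] at a3
  rw [show k - 2 + 1 = k - 1 by omega] at a2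
  have T1 : hatK k (thetaK k) 1 = k := by simp only [hatK, thetaK]; split_ifs <;> omega
  have T2 : hatK k (thetaK k) 2 = 3 := by simp only [hatK, thetaK]; split_ifs <;> omega
  have T3 : hatK k (thetaK k) 3 = 4 := by simp only [hatK, thetaK]; split_ifs <;> omega
  have T4 : hatK k (thetaK k) 4 = 1 := by simp only [hatK, thetaK]; split_ifs <;> omega
  have T5 : hatK k (thetaK k) 5 = 2 := by simp only [hatK, thetaK]; split_ifs <;> omega
  by_cases c1 : i.1 = 0
  · simp only [c1, zero_add, T1, T2]
    rw [min_eq_right (by omega), max_eq_left (by omega)]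
    rw [Fk, F3]
    have hf : (fun c => FF k 1 c - FF k 2 c) = fun c => (-8) * RR (k - 4) c + (-4) * RR (k - 3) c
        + 3 * RR (k - 2) c + (-1) * RR (k - 5) c := by
      funext c; rw [F1, F2]; ring
    rw [hf, act_lin, a5, a4, a3, a2, hrec]; ring
  by_cases c2 : i.1 = 1
  · simp only [c2, Nat.reduceAdd, T2, T3]
    rw [min_eq_left (by omega), max_eq_right (by omega)]
    rw [F4, F3]
    have hf : (fun c => FF k 2 c - FF k 3 c) = fun c => 7 * RR (k - 4) c + 2 * RR (k - 3) c
        + (-2) * RR (k - 2) c + 1 * RR (k - 5) c := by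
      funext c; rw [F2, F3]; ring
    rw [hf, act_lin, a5, a4, a3, a2, hrec]; ring
  by_cases c3 : i.1 = 2
  · simp only [c3, Nat.reduceAdd, T3, T4]
    rw [min_eq_right (by omega), max_eq_left (by omega)]
    rw [F4, F1]
    have hf : (fun c => FF k 3 c - FF k 4 c) = fun c => 5 * RR (k - 4) c + 3 * RR (k - 3) c
        + (-2) * RR (k - 2) c + 0 * RR (k - 5) c := by
      funext c; rw [F3, F4]; ring
    rw [hf, act_lin, a5, a4, a3, a2, hrec]; ring
  by_cases c4 : i.1 = 3
  · simp only [c4, Nat.reduceAdd, T4, T5]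
    rw [min_eq_left (by omega), max_eq_right (by omega)]
    rw [F1, F2]
    have hf : (fun c => FF k 4 c - FF k 5 c) = fun c => (-12) * RR (k - 4) c + (-5) * RR (k - 3) c
        + 4 * RR (k - 2) c + (-1) * RR (k - 1 - 5) c := by
      funext c; rw [F4, F5 5 c le_rfl (by omega)]; ring
    rw [hf, act_lin, hact (k - 1 - 5), a4, a3, a2, hrec,
      show k - 1 - 5 + 1 = k - 5 by omega]; ring
  have hT (r : ℕ) (h : 5 ≤ r) (h' : r < k) :
      FF k (hatK k (thetaK k) r) (j.1 + 1) = RR (k - r) (j.1 + 1) := by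
    by_cases h5 : r = 5
    · subst h5; rw [T5, F2]
    · have : hatK k (thetaK k) r = r - 1 := by simp only [hatK, thetaK]; split_ifs <;> omega
      rw [this, F5 _ _ (by omega) (by omega)]
      congr 1; omega
  have hle : hatK k (thetaK k) (i.1 + 1) ≤ hatK k (thetaK k) (i.1 + 2) := by
    simp only [hatK, thetaK]; split_ifs <;> omega
  rw [min_eq_left hle, max_eq_right hle, hT _ (by omega) (by omega)]
  by_cases c5 : i.1 + 2 = k
  · have : hatK k (thetaK k) (i.1 + 2) = k := by simp [hatK, c5]
    rw [this, Fk]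
    have hf : (fun c => FF k (i.1 + 1) c - FF k (i.1 + 2) c) =
        fun c => 1 * RR (k - 1 - (i.1 + 1)) c + 0 * RR 0 c + 0 * RR 0 c + 0 * RR 0 c := by
      funext c; rw [c5, Fk, F5 _ c (by omega) (by omega)]; ring
    rw [hf, act_lin, hact (k - 1 - (i.1 + 1)),
      show k - 1 - (i.1 + 1) + 1 = k - (i.1 + 1) by omega]; ring
  · have hf : (fun c => FF k (i.1 + 1) c - FF k (i.1 + 2) c) =
        fun c => 1 * RR (k - 1 - (i.1 + 1)) c + (-1) * RR (k - 1 - (i.1 + 2)) c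
          + 0 * RR 0 c + 0 * RR 0 c := by
      funext c; rw [F5 _ c (by omega) (by omega), F5 _ c (by omega) (by omega)]; ring
    rw [hT _ (by omega) (by omega), hf, act_lin, hact (k - 1 - (i.1 + 1)),
      hact (k - 1 - (i.1 + 2)), show k - 1 - (i.1 + 1) + 1 = k - (i.1 + 1) by omega,
      show k - 1 - (i.1 + 2) + 1 = k - (i.1 + 2) by omega]; ring

/-- Unit vectors with a one-based index. -/
def EE (k c : ℕ) : Fin (k - 1) → ℝ := fun i => if i.1 + 1 = c then 1 else 0

theorem mulVec_EE (k c : ℕ) (h : 1 ≤ c) (h' : c < k) (M : Matrix (Fin (k - 1)) (Fin (k - 1)) ℝ) :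
    M *ᵥ EE k c = fun i => M i ⟨c - 1, by omega⟩ := by
  have : EE k c = Pi.single (⟨c - 1, by omega⟩ : Fin (k - 1)) 1 := by
    funext i
    simp only [EE, Pi.single_apply, Fin.ext_iff]
    congr 1
    apply propext
    omega
  rw [this]
  ext i
  simp

set_option maxHeartbeats 4000000 in
theorem QQ_unit (k : ℕ) (hk : 6 ≤ k) : IsUnit (QQ k) := by
  set N := petrie k (hatK k (thetaK k)) with hN
  set W := LinearMap.range (QQ k).mulVecLin with hW
  have inv : ∀ v ∈ W, N *ᵥ v ∈ W := by
    rintro _ ⟨x, rfl⟩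
    refine ⟨petrie k (hatK k (alphaK k)) *ᵥ x, ?_⟩
    simp only [Matrix.mulVecLin_apply, Matrix.mulVec_mulVec]
    rw [QQ_inter k hk]
  have col (c : ℕ) (h : 1 ≤ c) (h' : c < k) (v : Fin (k - 1) → ℝ)
      (hv : ∀ i : Fin (k - 1), N i ⟨c - 1, by omega⟩ = v i) : N *ᵥ EE k c = v := by
    rw [mulVec_EE k c h h']; funext i; exact hv i
  have entry (i : Fin (k - 1)) (c : ℕ) (h : 1 ≤ c) (h' : c < k) : N i ⟨c - 1, by omega⟩ =
      if (i.1 + 1 = 1 ∧ 3 ≤ c) ∨ (i.1 + 1 = 2 ∧ c = 3) ∨ (i.1 + 1 = 3 ∧ c ≤ 3) ∨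
        (i.1 + 1 = 4 ∧ c = 1) ∨ (i.1 + 1 = 5 ∧ 2 ≤ c ∧ c ≤ 4) ∨ (6 ≤ i.1 + 1 ∧ i.1 = c) ∨
        (i.1 + 2 = k ∧ c = k - 1) then 1 else 0 := by
    have hi := i.2
    simp only [hN, petrie, Matrix.of_apply]
    congr 1
    apply propext
    simp only [hatK, thetaK]
    split_ifs <;> omega
  have N1 : N *ᵥ EE k 1 = EE k 3 + EE k 4 := by
    refine col 1 (by omega) (by omega) _ fun i => ?_
    have hi := i.2
    rw [entry i 1 (by omega) (by omega)]
    simp only [EE, Pi.add_apply, and_true]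
    split_ifs <;> first | omega | norm_num
  have N2 : N *ᵥ EE k 2 = EE k 3 + EE k 5 := by
    refine col 2 (by omega) (by omega) _ fun i => ?_
    have hi := i.2
    rw [entry i 2 (by omega) (by omega)]
    simp only [EE, Pi.add_apply, and_true]
    split_ifs <;> first | omega | norm_num
  have N3 : N *ᵥ EE k 3 = EE k 1 + EE k 2 + EE k 3 + EE k 5 := by
    refine col 3 (by omega) (by omega) _ fun i => ?_
    have hi := i.2
    rw [entry i 3 (by omega) (by omega)]
    simp only [EE, Pi.add_apply, and_true]
    split_ifs <;> first | omega | norm_num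
  have N4 : N *ᵥ EE k 4 = EE k 1 + EE k 5 := by
    refine col 4 (by omega) (by omega) _ fun i => ?_
    have hi := i.2
    rw [entry i 4 (by omega) (by omega)]
    simp only [EE, Pi.add_apply, and_true]
    split_ifs <;> first | omega | norm_num
  let S : ℕ → Fin (k - 1) → ℝ := fun c => EE k (min c (k - 1))
  have NS (c : ℕ) (hc : 5 ≤ c) : N *ᵥ S c = EE k 1 + S (c + 1) := by
    refine col (min c (k - 1)) (by omega) (by omega) _ fun i => ?_
    have hi := i.2
    rw [entry i _ (by omega) (by omega)]
    simp only [S, EE, Pi.add_apply, and_true]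
    split_ifs <;> first | omega | norm_num
  have S5 : S 5 = EE k 5 := by simp only [S]; rw [min_eq_left (by omega)]
  have wlast : EE k (k - 1) ∈ W := by
    refine ⟨EE k (k - 1), ?_⟩
    rw [Matrix.mulVecLin_apply, mulVec_EE k (k - 1) (by omega) (by omega)]
    funext i
    rw [QQ_last k hk i _ (by simp; omega)]
    simp only [EE]
    congr 1
    apply propext
    omega
  have Slast (c : ℕ) (hc : k - 1 ≤ c) : S c ∈ W := by
    simp only [S]; rw [min_eq_right hc]; exact wlast
  have w1 : EE k 1 ∈ W := by
    have h := inv _ (Slast (k - 1) le_rfl)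
    rw [NS _ (by omega)] at h
    have := W.sub_mem h (Slast (k - 1 + 1) (by omega))
    simpa using this
  have w34 : EE k 3 + EE k 4 ∈ W := N1 ▸ inv _ w1
  have u1 : EE k 2 + EE k 3 + (2 : ℝ) • S 5 ∈ W := by
    have h := inv _ w34
    rw [Matrix.mulVec_add, N3, N4, ← S5] at h
    have := W.sub_mem h (W.smul_mem 2 w1)
    convert this using 1
    module
  have u2 : EE k 2 + (2 : ℝ) • EE k 3 + (2 : ℝ) • S 5 + (2 : ℝ) • S 6 ∈ W := by
    have h := inv _ u1
    rw [Matrix.mulVec_add, Matrix.mulVec_add, Matrix.mulVec_smul, N2, N3, NS 5 le_rfl, ← S5] at h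
    have := W.sub_mem h (W.smul_mem 3 w1)
    convert this using 1
    module
  have u3 : EE k 4 - (2 : ℝ) • S 6 ∈ W := by
    have := W.add_mem (W.sub_mem w34 u2) u1
    convert this using 1
    module
  have v5 : S 5 - (2 : ℝ) • S 7 ∈ W := by
    have h := inv _ u3
    rw [Matrix.mulVec_sub, Matrix.mulVec_smul, N4, NS 6 (by omega), ← S5] at h
    have := W.add_mem h w1
    convert this using 1
    module
  have vv (c : ℕ) : S (5 + c) - (2 : ℝ) • S (5 + c + 2) ∈ W := by
    induction c with
    | zero => exact v5
    | succ c ih =>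
      have h := inv _ ih
      rw [Matrix.mulVec_sub, Matrix.mulVec_smul, NS _ (by omega), NS _ (by omega)] at h
      have := W.add_mem h w1
      convert this using 1
      rw [show 5 + c + 2 + 1 = 5 + (c + 1) + 2 by omega, show 5 + c + 1 = 5 + (c + 1) by omega]
      module
  have wS : ∀ d c : ℕ, 5 ≤ c → k ≤ c + d → S c ∈ W := by
    intro d
    induction d using Nat.strong_induction_on with
    | _ d ih =>
      intro c hc hd
      by_cases h : k - 1 ≤ c
      · exact Slast c h
      · obtain ⟨e, rfl⟩ : ∃ e, c = 5 + e := ⟨c - 5, by omega⟩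
        have h2 : S (5 + e + 2) ∈ W := ih (d - 2) (by omega) _ (by omega) (by omega)
        have := W.add_mem (vv e) (W.smul_mem 2 h2)
        simpa using this
  have w4 : EE k 4 ∈ W := by
    have := W.add_mem u3 (W.smul_mem 2 (wS k 6 (by omega) (by omega)))
    simpa using this
  have w3 : EE k 3 ∈ W := by
    have := W.sub_mem w34 w4
    simpa using this
  have w2 : EE k 2 ∈ W := by
    have := W.sub_mem (W.sub_mem u1 w3) (W.smul_mem 2 (wS k 5 (by omega) (by omega)))
    convert this using 1
    module
  have wall (c : ℕ) (h1 : 1 ≤ c) (h2 : c < k) : EE k c ∈ W := by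
    by_cases h : 5 ≤ c
    · have := wS k c h (by omega)
      simp only [S] at this
      rwa [min_eq_left (by omega)] at this
    · interval_cases c <;> assumption
  have htop : W = ⊤ := by
    rw [eq_top_iff]
    intro v _
    have : v = ∑ i : Fin (k - 1), v i • EE k (i.1 + 1) := by
      funext j
      simp [EE, Finset.sum_apply, Fin.val_inj]
    rw [this]
    exact W.sum_mem fun i _ => W.smul_mem _ (wall _ (by omega) (by omega))
  rw [← Matrix.mulVec_surjective_iff_isUnit]
  intro v
  have : v ∈ W := htop ▸ Submodule.mem_top
  obtain ⟨x, hx⟩ := this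
  exact ⟨x, hx⟩

/-- The condition for a nonzero entry, zero-based. -/
def pc (σ : ℕ → ℕ) (i j : ℕ) : Prop :=
  min (σ (i + 1)) (σ (i + 2)) ≤ j + 1 ∧ j + 1 ≤ max (σ (i + 1)) (σ (i + 2)) - 1

instance (σ : ℕ → ℕ) (i j : ℕ) : Decidable (pc σ i j) := by unfold pc; infer_instance

theorem petrie_apply (n : ℕ) (σ : ℕ → ℕ) (i j : Fin (n - 1)) :
    petrie n σ i j = if pc σ i.1 j.1 then 1 else 0 := by
  simp only [petrie, Matrix.of_apply, pc]

theorem trace_petrie (n : ℕ) (σ : ℕ → ℕ) : (petrie n σ).trace =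
    (((Finset.range (n - 1)).filter fun i => pc σ i i).card : ℝ) := by
  simp only [Matrix.trace, Matrix.diag_apply, petrie_apply]
  rw [Fin.sum_univ_eq_sum_range (fun i => if pc σ i i then (1 : ℝ) else 0) (n - 1)]
  simp

theorem trace_sq_petrie (n : ℕ) (σ : ℕ → ℕ) : (petrie n σ * petrie n σ).trace =
    ((((Finset.range (n - 1)) ×ˢ (Finset.range (n - 1))).filter
      fun p => pc σ p.1 p.2 ∧ pc σ p.2 p.1).card : ℝ) := by
  simp only [Matrix.trace, Matrix.diag_apply, Matrix.mul_apply, petrie_apply]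
  rw [Finset.card_filter, Finset.sum_product, Nat.cast_sum]
  rw [← Fin.sum_univ_eq_sum_range (fun i => ((∑ j ∈ Finset.range (n - 1),
    if pc σ i j ∧ pc σ j i then 1 else 0 : ℕ) : ℝ)) (n - 1)]
  apply Finset.sum_congr rfl
  intro i _
  rw [Nat.cast_sum, ← Fin.sum_univ_eq_sum_range (fun j => ((
    if pc σ i j ∧ pc σ j i then 1 else 0 : ℕ) : ℝ)) (n - 1)]
  apply Finset.sum_congr rfl
  intro j _
  by_cases h1 : pc σ i j <;> by_cases h2 : pc σ j i <;> simp [h1, h2]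

theorem isPermOn_of (n : ℕ) (σ : ℕ → ℕ) (h1 : ∀ i, 1 ≤ i → i ≤ n → 1 ≤ σ i ∧ σ i ≤ n)
    (h2 : ∀ i j, 1 ≤ i → i ≤ n → 1 ≤ j → j ≤ n → σ i = σ j → i = j) : IsPermOn n σ := by
  have hm : Set.MapsTo σ (Set.Icc 1 n) (Set.Icc 1 n) := fun i hi => h1 i hi.1 hi.2
  have hi : Set.InjOn σ (Set.Icc 1 n) := fun i hi j hj h => h2 i j hi.1 hi.2 hj.1 hj.2 h
  refine ⟨hm, hi, ?_⟩
  have := Finset.surjOn_of_injOn_of_card_le (s := Finset.Icc 1 n) (t := Finset.Icc 1 n) σ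
    (by simpa using hm) (by simpa using hi) le_rfl
  simpa using this

def aL (k i : ℕ) : ℕ :=
  if i = 1 then 4 else if i = 2 then 1 else if i = 3 then 6 else if i = 4 then 3
  else if i = 5 then 2 else if i ≤ k then i + 1 else 5

def tL (k i : ℕ) : ℕ :=
  if i = 1 then k + 1 else if i = 2 then 1 else if i = 3 then 4 else if i = 4 then 5
  else if i = 5 then 2 else if i = 6 then 3 else i - 1

def tT (k i : ℕ) : ℕ :=
  if i = 1 then k + 1 else if i = 2 then 1 else if i = 3 then 4 else if i = 4 then 5
  else if i = 5 then 2 else if i = k + 1 then k + 2 else if i = k + 2 then (if k = 5 then 3 else k)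
  else if i = 6 then 3 else i - 1

theorem alphaK_cases (k i : ℕ) (hk : 5 ≤ k) (h1 : 1 ≤ i) (h2 : i ≤ k) :
    (i = 1 ∧ alphaK k i = 3) ∨ (i = 2 ∧ alphaK k i = 5) ∨ (i = 3 ∧ alphaK k i = 2) ∨
    (i = 4 ∧ alphaK k i = 1) ∨ (5 ≤ i ∧ i < k ∧ alphaK k i = i + 1) ∨ (i = k ∧ alphaK k i = 4) := by
  generalize h : alphaK k i = x
  simp only [alphaK] at h
  split_ifs at h <;> omega

theorem thetaK_cases (k i : ℕ) (hk : 5 ≤ k) (h1 : 1 ≤ i) (h2 : i ≤ k) :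
    (i = 1 ∧ thetaK k i = k) ∨ (i = 2 ∧ thetaK k i = 3) ∨ (i = 3 ∧ thetaK k i = 4) ∨
    (i = 4 ∧ thetaK k i = 1) ∨ (i = 5 ∧ thetaK k i = 2) ∨
    (6 ≤ i ∧ i ≤ k ∧ thetaK k i = i - 1) := by
  generalize h : thetaK k i = x
  simp only [thetaK] at h
  split_ifs at h <;> omega

theorem aL_cases (k i : ℕ) (hk : 5 ≤ k) (h1 : 1 ≤ i) (h2 : i ≤ k + 1) :
    (i = 1 ∧ aL k i = 4) ∨ (i = 2 ∧ aL k i = 1) ∨ (i = 3 ∧ aL k i = 6) ∨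
    (i = 4 ∧ aL k i = 3) ∨ (i = 5 ∧ aL k i = 2) ∨ (6 ≤ i ∧ i ≤ k ∧ aL k i = i + 1) ∨
    (i = k + 1 ∧ aL k i = 5) := by
  generalize h : aL k i = x
  simp only [aL] at h
  split_ifs at h <;> omega

theorem tL_cases (k i : ℕ) (hk : 5 ≤ k) (h1 : 1 ≤ i) (h2 : i ≤ k + 1) :
    (i = 1 ∧ tL k i = k + 1) ∨ (i = 2 ∧ tL k i = 1) ∨ (i = 3 ∧ tL k i = 4) ∨
    (i = 4 ∧ tL k i = 5) ∨ (i = 5 ∧ tL k i = 2) ∨ (i = 6 ∧ tL k i = 3) ∨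
    (7 ≤ i ∧ tL k i = i - 1) := by
  generalize h : tL k i = x
  simp only [tL] at h
  split_ifs at h <;> omega

theorem tT_cases (k i : ℕ) (hk : 5 ≤ k) (h1 : 1 ≤ i) (h2 : i ≤ k + 2) :
    (i = 1 ∧ tT k i = k + 1) ∨ (i = 2 ∧ tT k i = 1) ∨ (i = 3 ∧ tT k i = 4) ∨
    (i = 4 ∧ tT k i = 5) ∨ (i = 5 ∧ tT k i = 2) ∨ (i = 6 ∧ i ≤ k ∧ tT k i = 3) ∨
    (7 ≤ i ∧ i ≤ k ∧ tT k i = i - 1) ∨ (i = k + 1 ∧ tT k i = k + 2) ∨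
    (i = k + 2 ∧ k = 5 ∧ tT k i = 3) ∨ (i = k + 2 ∧ k ≠ 5 ∧ tT k i = k) := by
  have hT : tT k i = if i = 1 then k + 1 else if i = 2 then 1 else if i = 3 then 4 else if i = 4
    then 5 else if i = 5 then 2 else if i = k + 1 then k + 2 else if i = k + 2 then
    (if k = 5 then 3 else k) else if i = 6 then 3 else i - 1 := rfl
  by_cases c1 : i = 1
  · left; rw [hT, if_pos c1]; omega
  rw [if_neg c1] at hT; right
  by_cases c2 : i = 2
  · left; rw [hT, if_pos c2]; omega
  rw [if_neg c2] at hT; right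
  by_cases c3 : i = 3
  · left; rw [hT, if_pos c3]; omega
  rw [if_neg c3] at hT; right
  by_cases c4 : i = 4
  · left; rw [hT, if_pos c4]; omega
  rw [if_neg c4] at hT; right
  by_cases c5 : i = 5
  · left; rw [hT, if_pos c5]; omega
  rw [if_neg c5] at hT; right
  by_cases c6 : i = k + 1
  · right; right; left; rw [hT, if_pos c6]; omega
  rw [if_neg c6] at hT
  by_cases c7 : i = k + 2
  · rw [if_pos c7] at hT
    right; right; right
    by_cases c9 : k = 5
    · left; rw [hT, if_pos c9]; omega
    · right; rw [hT, if_neg c9]; omega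
  rw [if_neg c7] at hT
  by_cases c8 : i = 6
  · left; rw [hT, if_pos c8]; omega
  · right; left; rw [hT, if_neg c8]; omega

theorem aL_perm (k : ℕ) (hk : 5 ≤ k) : IsPermOn (1 + k) (aL k) := by
  apply isPermOn_of
  · intro i h1 h2
    have c := aL_cases k i (by omega) (by omega) (by omega)
    omega
  · intro i j h1 h2 h3 h4 h
    have c := aL_cases k i (by omega) (by omega) (by omega)
    have d := aL_cases k j (by omega) (by omega) (by omega)
    rcases c with c | c | c | c | c | c | c <;>
      rcases d with d | d | d | d | d | d | d <;> omega

theorem tL_perm (k : ℕ) (hk : 5 ≤ k) : IsPermOn (1 + k) (tL k) := by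
  apply isPermOn_of
  · intro i h1 h2
    have c := tL_cases k i (by omega) (by omega) (by omega)
    omega
  · intro i j h1 h2 h3 h4 h
    have c := tL_cases k i (by omega) (by omega) (by omega)
    have d := tL_cases k j (by omega) (by omega) (by omega)
    rcases c with c | c | c | c | c | c | c <;>
      rcases d with d | d | d | d | d | d | d <;> omega

theorem tT_perm (k : ℕ) (hk : 5 ≤ k) : IsPermOn (1 + k + 1) (tT k) := by
  apply isPermOn_of
  · intro i h1 h2
    have c := tT_cases k i (by omega) (by omega) (by omega)
    omega
  · intro i j h1 h2 h3 h4 h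
    have c := tT_cases k i (by omega) (by omega) (by omega)
    have d := tT_cases k j (by omega) (by omega) (by omega)
    rcases c with c | c | c | c | c | c | c | c | c | c <;>
      rcases d with d | d | d | d | d | d | d | d | d | d <;> omega

theorem left_sync (k : ℕ) (hk : 5 ≤ k) :
    IsSyncLeftExt k 1 (alphaK k) (thetaK k) (aL k) (tL k) := by
  have a1 : aL k 1 = 1 + alphaK k 1 := by simp [aL, alphaK]
  have t1 : tL k 1 = 1 + thetaK k 1 := by simp [tL, thetaK]; omega
  refine ⟨⟨aL_perm k hk, ?_, 1, le_rfl, le_rfl, a1, ?_⟩,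
    ⟨tL_perm k hk, ?_, 1, le_rfl, le_rfl, t1, ?_⟩, 1, le_rfl, le_rfl, a1, t1, ?_⟩
  · intro i h1 h2
    have c := aL_cases k (1 + i) (by omega) (by omega) (by omega)
    have d := alphaK_cases k i (by omega) (by omega) (by omega)
    rcases c with c | c | c | c | c | c | c <;>
      rcases d with d | d | d | d | d | d <;> omega
  · intro j h1 h2 h3
    have c := aL_cases k j (by omega) (by omega) (by omega)
    omega
  · intro i h1 h2
    have c := tL_cases k (1 + i) (by omega) (by omega) (by omega)
    have d := thetaK_cases k i (by omega) (by omega) (by omega)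
    rcases c with c | c | c | c | c | c | c <;>
      rcases d with d | d | d | d | d | d <;> omega
  · intro j h1 h2 h3
    have c := tL_cases k j (by omega) (by omega) (by omega)
    omega
  · intro j h1 h2 h3
    have c := aL_cases k j (by omega) (by omega) (by omega)
    have d := tL_cases k j (by omega) (by omega) (by omega)
    rcases c with c | c | c | c | c | c | c <;>
      rcases d with d | d | d | d | d | d | d <;> omega

theorem two_sync (k : ℕ) (hk : 5 ≤ k) :
    IsSyncTwoSidedExt k 1 1 (alphaK k) (thetaK k) (aL (k + 1)) (tT k) := by
  have a1 : aL (k + 1) 1 = 1 + alphaK k 1 := by simp [aL, alphaK]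
  have a2 : aL (k + 1) (1 + k + 1) = 1 + alphaK k k := by
    have c := aL_cases (k + 1) (1 + k + 1) (by omega) (by omega) (by omega)
    have d := alphaK_cases k k (by omega) (by omega) (by omega)
    rcases c with c | c | c | c | c | c | c <;>
      rcases d with d | d | d | d | d | d <;> omega
  have t1 : tT k 1 = 1 + thetaK k 1 := by simp [tT, thetaK]; omega
  have t2 : tT k (1 + k + 1) = 1 + thetaK k k := by
    have c := tT_cases k (1 + k + 1) (by omega) (by omega) (by omega)
    have d := thetaK_cases k k (by omega) (by omega) (by omega)
    rcases c with c | c | c | c | c | c | c | c | c | c <;>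
      rcases d with d | d | d | d | d | d <;> omega
  have pa : IsPermOn (1 + k + 1) (aL (k + 1)) := by
    have := aL_perm (k + 1) (by omega)
    rwa [← add_assoc] at this
  refine ⟨⟨pa, ?_, ⟨1, le_rfl, le_rfl, a1, ?_⟩, ⟨1 + k + 1, le_rfl, le_rfl, a2, ?_⟩⟩,
    ⟨tT_perm k hk, ?_, ⟨1, le_rfl, le_rfl, t1, ?_⟩, ⟨1 + k + 1, le_rfl, le_rfl, t2, ?_⟩⟩,
    1, 1 + k + 1, le_rfl, le_rfl, le_rfl, le_rfl, a1, t1, a2, t2, ?_⟩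
  · intro i h1 h2
    have c := aL_cases (k + 1) (1 + i) (by omega) (by omega) (by omega)
    have d := alphaK_cases k i (by omega) (by omega) (by omega)
    rcases c with c | c | c | c | c | c | c <;>
      rcases d with d | d | d | d | d | d <;> omega
  · intro j h1 h2 h3
    have c := aL_cases (k + 1) j (by omega) (by omega) (by omega)
    omega
  · intro j h1 h2 h3
    have c := aL_cases (k + 1) j (by omega) (by omega) (by omega)
    omega
  · intro i h1 h2
    have c := tT_cases k (1 + i) (by omega) (by omega) (by omega)
    have d := thetaK_cases k i (by omega) (by omega) (by omega)
    rcases c with c | c | c | c | c | c | c | c | c | c <;>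
      rcases d with d | d | d | d | d | d <;> omega
  · intro j h1 h2 h3
    have c := tT_cases k j (by omega) (by omega) (by omega)
    omega
  · intro j h1 h2 h3
    have c := tT_cases k j (by omega) (by omega) (by omega)
    omega
  · intro j h1 h2 h3
    have c := aL_cases (k + 1) j (by omega) (by omega) (by omega)
    have d := tT_cases k j (by omega) (by omega) (by omega)
    rcases c with c | c | c | c | c | c | c <;>
      rcases d with d | d | d | d | d | d | d | d | d | d <;> omega

theorem not_sim (k : ℕ) (hk : 5 < k) : ¬ MatSimilar (petrie k (alphaK k)) (petrie k (thetaK k)) := by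
  intro h
  have h := h.trace_eq
  rw [trace_petrie, trace_petrie, Nat.cast_inj] at h
  have e1 : (Finset.range (k - 1)).filter (fun i => pc (alphaK k) i i) = {1, 3, k - 2} := by
    ext i
    rw [Finset.mem_filter]
    simp only [Finset.mem_range, Finset.mem_insert, Finset.mem_singleton]
    unfold pc
    by_cases hi : i < k - 1
    · have c := alphaK_cases k (i + 1) (by omega) (by omega) (by omega)
      have d := alphaK_cases k (i + 2) (by omega) (by omega) (by omega)
      rcases c with c | c | c | c | c | c <;>
        rcases d with d | d | d | d | d | d <;> omega
    · omega
  have e2 : (Finset.range (k - 1)).filter (fun i => pc (thetaK k) i i) = {2} := by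
    ext i
    rw [Finset.mem_filter]
    simp only [Finset.mem_range, Finset.mem_insert, Finset.mem_singleton]
    unfold pc
    by_cases hi : i < k - 1
    · have c := thetaK_cases k (i + 1) (by omega) (by omega) (by omega)
      have d := thetaK_cases k (i + 2) (by omega) (by omega) (by omega)
      rcases c with c | c | c | c | c | c <;>
        rcases d with d | d | d | d | d | d <;> omega
    · omega
  rw [e1, e2, Finset.card_insert_of_notMem (by simp <;> omega),
    Finset.card_insert_of_notMem (by simp <;> omega)] at h
  simp at h

theorem not_left (k : ℕ) (hk : 5 ≤ k) : ¬ LeftSimilar k (alphaK k) (thetaK k) := by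
  intro h
  have h := h 1 le_rfl _ _ (left_sync k hk)
  by_cases h5 : k = 5
  · subst h5
    have h := h.trace_sq_eq
    rw [trace_sq_petrie, trace_sq_petrie, Nat.cast_inj] at h
    revert h
    decide
  · have h := h.trace_eq
    rw [trace_petrie, trace_petrie, Nat.cast_inj] at h
    have e1 : (Finset.range (1 + k - 1)).filter (fun i => pc (aL k) i i) = {0, 1, 2, 4, k - 1} := by
      ext i
      rw [Finset.mem_filter]
      simp only [Finset.mem_range, Finset.mem_insert, Finset.mem_singleton]
      unfold pc
      by_cases hi : i < k
      · have c := aL_cases k (i + 1) (by omega) (by omega) (by omega)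
        have d := aL_cases k (i + 2) (by omega) (by omega) (by omega)
        rcases c with c | c | c | c | c | c | c <;>
          rcases d with d | d | d | d | d | d | d <;> omega
      · omega
    have e2 : (Finset.range (1 + k - 1)).filter (fun i => pc (tL k) i i) = {0, 1, 3} := by
      ext i
      rw [Finset.mem_filter]
      simp only [Finset.mem_range, Finset.mem_insert, Finset.mem_singleton]
      unfold pc
      by_cases hi : i < k
      · have c := tL_cases k (i + 1) (by omega) (by omega) (by omega)
        have d := tL_cases k (i + 2) (by omega) (by omega) (by omega)
        rcases c with c | c | c | c | c | c | c <;>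
          rcases d with d | d | d | d | d | d | d <;> omega
      · omega
    rw [e1, e2] at h
    iterate 4 rw [Finset.card_insert_of_notMem (by simp <;> omega)] at h
    simp at h

theorem tT_pc (k : ℕ) (hk : 5 ≤ k) (i j : ℕ) (hi : i < k + 1) (hj : j < k + 1) : pc (tT k) i j ↔
      (i = 0 ∧ j < k) ∨ (i = 1 ∧ j ≤ 2) ∨ (i = 2 ∧ j = 3) ∨ (i = 3 ∧ 1 ≤ j ∧ j ≤ 3) ∨
      (i = 4 ∧ j = 1) ∨ (i = 4 ∧ k = 5 ∧ 1 ≤ j) ∨ (i = 5 ∧ 2 ≤ j ∧ j ≤ 4) ∨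
      (6 ≤ i ∧ i < k ∧ j + 1 = i) ∨
      (i = k - 1 ∧ k - 2 ≤ j) ∨ (i = k - 1 ∧ k = 6 ∧ 2 ≤ j) ∨ (i = k ∧ k - 1 ≤ j) ∨
      (i = k ∧ k = 5 ∧ 2 ≤ j) := by
  by_cases k5 : k = 5
  · subst k5
    interval_cases i <;> simp [pc, tT] <;> omega
  by_cases k6 : k = 6
  · subst k6
    interval_cases i <;> simp [pc, tT] <;> omega
  have v1 : tT k 1 = k + 1 := by simp [tT]
  have v2 : tT k 2 = 1 := by simp [tT]
  have v3 : tT k 3 = 4 := by simp [tT]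
  have v4 : tT k 4 = 5 := by simp [tT]
  have v5 : tT k 5 = 2 := by simp [tT]
  have v (r : ℕ) (h : 6 ≤ r) : tT k r = if r = k + 1 then k + 2 else if r = k + 2 then k
      else if r = 6 then 3 else r - 1 := by
    simp only [tT, k5, if_false]
    rw [if_neg (by omega), if_neg (by omega), if_neg (by omega), if_neg (by omega),
      if_neg (by omega)]
  have v6 : tT k 6 = 3 := by
    rw [v 6 (by omega), if_neg (by omega), if_neg (by omega), if_pos rfl]
  have vk1 : tT k (k + 1) = k + 2 := by
    rw [v _ (by omega), if_pos rfl]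
  have vk2 : tT k (k + 2) = k := by
    rw [v _ (by omega), if_neg (by omega), if_pos rfl]
  have vm (r : ℕ) (h : 7 ≤ r) (h' : r ≤ k) : tT k r = r - 1 := by
    rw [v _ (by omega), if_neg (by omega), if_neg (by omega), if_neg (by omega)]
  unfold pc
  by_cases h0 : i < 6
  · have v7 : tT k 7 = 6 := vm 7 (by omega) (by omega)
    have hk7 : 7 ≤ k := by omega
    clear vm v vk1 vk2
    have key (x y : ℕ) (hx : tT k (i + 1) = x) (hy : tT k (i + 2) = y)
        (hxy : (i = 0 ∧ x = k + 1 ∧ y = 1) ∨ (i = 1 ∧ x = 1 ∧ y = 4) ∨ (i = 2 ∧ x = 4 ∧ y = 5) ∨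
          (i = 3 ∧ x = 5 ∧ y = 2) ∨ (i = 4 ∧ x = 2 ∧ y = 3) ∨ (i = 5 ∧ x = 3 ∧ y = 6)) :
        (min (tT k (i + 1)) (tT k (i + 2)) ≤ j + 1 ∧
          j + 1 ≤ max (tT k (i + 1)) (tT k (i + 2)) - 1) ↔
        (i = 0 ∧ j < k) ∨ (i = 1 ∧ j ≤ 2) ∨ (i = 2 ∧ j = 3) ∨ (i = 3 ∧ 1 ≤ j ∧ j ≤ 3) ∨
        (i = 4 ∧ j = 1) ∨ (i = 5 ∧ 2 ≤ j ∧ j ≤ 4) := by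
      rw [hx, hy]
      clear hx hy v1 v2 v3 v4 v5 v6 v7
      rcases hxy with h | h | h | h | h | h <;> obtain ⟨rfl, rfl, rfl⟩ := h <;> omega
    have n1 : ¬ (i = 4 ∧ k = 5 ∧ 1 ≤ j) := by omega
    have n2 : ¬ (6 ≤ i ∧ i < k ∧ j + 1 = i) := by omega
    have n3 : ¬ (i = k - 1 ∧ k - 2 ≤ j) := by omega
    have n4 : ¬ (i = k - 1 ∧ k = 6 ∧ 2 ≤ j) := by omega
    have n5 : ¬ (i = k ∧ k - 1 ≤ j) := by omega
    have n6 : ¬ (i = k ∧ k = 5 ∧ 2 ≤ j) := by omega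
    have hd : i = 0 ∨ i = 1 ∨ i = 2 ∨ i = 3 ∨ i = 4 ∨ i = 5 := by omega
    have key2 : (min (tT k (i + 1)) (tT k (i + 2)) ≤ j + 1 ∧
          j + 1 ≤ max (tT k (i + 1)) (tT k (i + 2)) - 1) ↔
        (i = 0 ∧ j < k) ∨ (i = 1 ∧ j ≤ 2) ∨ (i = 2 ∧ j = 3) ∨ (i = 3 ∧ 1 ≤ j ∧ j ≤ 3) ∨
        (i = 4 ∧ j = 1) ∨ (i = 5 ∧ 2 ≤ j ∧ j ≤ 4) := by
      clear n1 n2 n3 n4 n5 n6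
      rcases hd with h | h | h | h | h | h
      · exact key (k + 1) 1 (by rw [h]; exact v1) (by rw [h]; exact v2) (by omega)
      · exact key 1 4 (by rw [h]; exact v2) (by rw [h]; exact v3) (by omega)
      · exact key 4 5 (by rw [h]; exact v3) (by rw [h]; exact v4) (by omega)
      · exact key 5 2 (by rw [h]; exact v4) (by rw [h]; exact v5) (by omega)
      · exact key 2 3 (by rw [h]; exact v5) (by rw [h]; exact v6) (by omega)
      · exact key 3 6 (by rw [h]; exact v6) (by rw [h]; exact v7) (by omega)
    rw [key2]
    simp only [n1, n2, n3, n4, n5, n6, or_false, false_or]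
  by_cases h1 : i = k
  · subst h1
    rw [vk1, vk2]; omega
  rw [vm (i + 1) (by omega) (by omega)]
  by_cases h2 : i + 1 = k
  · rw [show i + 2 = k + 1 by omega, vk1]; omega
  · rw [vm (i + 2) (by omega) (by omega)]; omega

set_option maxHeartbeats 4000000 in
theorem not_two (k : ℕ) (hk : 5 ≤ k) : ¬ TwoSidedSimilar k (alphaK k) (thetaK k) := by
  intro h
  have h := h 1 1 le_rfl le_rfl _ _ (two_sync k hk)
  have h := h.trace_sq_eq
  rw [trace_sq_petrie, trace_sq_petrie, Nat.cast_inj] at h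
  have ha (i j : ℕ) (hi : i < k + 1) (hj : j < k + 1) : pc (aL (k + 1)) i j ↔
      (i = 0 ∧ j ≤ 2) ∨ (i = 1 ∧ j ≤ 4) ∨ (i = 2 ∧ 2 ≤ j ∧ j ≤ 4) ∨ (i = 3 ∧ j = 1) ∨
      (i = 4 ∧ 1 ≤ j ∧ j ≤ 5) ∨ (5 ≤ i ∧ i < k ∧ j = i + 1) ∨ (i = k ∧ 4 ≤ j) := by
    unfold pc
    have c := aL_cases (k + 1) (i + 1) (by omega) (by omega) (by omega)
    have d := aL_cases (k + 1) (i + 2) (by omega) (by omega) (by omega)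
    rcases c with c | c | c | c | c | c | c <;>
      rcases d with d | d | d | d | d | d | d <;> omega
  have ht := tT_pc k hk
  have e1 : ((Finset.range (1 + k + 1 - 1)) ×ˢ (Finset.range (1 + k + 1 - 1))).filter
      (fun p => pc (aL (k + 1)) p.1 p.2 ∧ pc (aL (k + 1)) p.2 p.1) =
      {(0, 0), (0, 1), (1, 0), (1, 1), (1, 3), (3, 1), (1, 4), (4, 1), (2, 2), (2, 4), (4, 2),
        (4, 4), (k - 1, k), (k, k - 1), (k, k)} := by
    ext ⟨i, j⟩
    rw [Finset.mem_filter, Finset.mem_product]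
    simp only [Finset.mem_range, Finset.mem_insert, Finset.mem_singleton, Prod.mk.injEq]
    constructor
    · rintro ⟨⟨hi, hj⟩, c, d⟩
      rw [ha i j (by omega) (by omega)] at c
      rw [ha j i (by omega) (by omega)] at d
      clear h
      rcases c with c | c | c | c | c | c | c <;>
        rcases d with d | d | d | d | d | d | d <;>
        first
        | (exfalso; omega)
        | (repeat (first | exact ⟨by omega, by omega⟩ | exact Or.inl ⟨by omega, by omega⟩ | right))
    · clear h
      intro c
      rcases c with
        c | c | c | c | c | c | c | c | c | c | c | c | c | c | c <;>
        exact ⟨⟨by omega, by omega⟩, (ha i j (by omega) (by omega)).2 (by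
            first | ((repeat (first | (left; omega) | right)); done) | omega),
          (ha j i (by omega) (by omega)).2 (by
            first | ((repeat (first | (left; omega) | right)); done) | omega)⟩
  have e2 : ((Finset.range (1 + k + 1 - 1)) ×ˢ (Finset.range (1 + k + 1 - 1))).filter
      (fun p => pc (tT k) p.1 p.2 ∧ pc (tT k) p.2 p.1) =
      {(0, 0), (0, 1), (1, 0), (1, 1), (2, 3), (3, 2), (3, 3),
        (k - 1, k - 1), (k - 1, k), (k, k - 1), (k, k)} := by
    ext ⟨i, j⟩
    rw [Finset.mem_filter, Finset.mem_product]
    simp only [Finset.mem_range, Finset.mem_insert, Finset.mem_singleton, Prod.mk.injEq]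
    constructor
    · rintro ⟨⟨hi, hj⟩, c, d⟩
      rw [ht i j (by omega) (by omega)] at c
      rw [ht j i (by omega) (by omega)] at d
      clear h
      rcases c with c | c | c | c | c | c | c | c | c | c | c | c <;>
        rcases d with d | d | d | d | d | d | d | d | d | d | d | d <;>
        first
        | (exfalso; omega)
        | (repeat (first | exact ⟨by omega, by omega⟩ | exact Or.inl ⟨by omega, by omega⟩ | right))
    · clear h
      intro c
      rcases c with
        c | c | c | c | c | c | c | c | c | c | c <;>
        exact ⟨⟨by omega, by omega⟩, (ht i j (by omega) (by omega)).2 (by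
            first | ((repeat (first | (left; omega) | right)); done) | omega),
          (ht j i (by omega) (by omega)).2 (by
            first | ((repeat (first | (left; omega) | right)); done) | omega)⟩
  rw [e1, e2] at h
  iterate 24 rw [Finset.card_insert_of_notMem (by simp <;> omega)] at h
  simp at h


def MA5 : Matrix (Fin 4) (Fin 4) ℝ := !![0,0,1,1; 0,1,1,1; 1,0,0,0; 1,1,1,0]
def MT5 : Matrix (Fin 4) (Fin 4) ℝ := !![0,0,1,1; 0,0,1,0; 1,1,1,0; 1,0,0,0]
def NA5 : Matrix (Fin 4) (Fin 4) ℝ := !![0,0,1,1; 0,1,1,1; 1,0,0,0; 1,1,1,1]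
def NT5 : Matrix (Fin 4) (Fin 4) ℝ := !![0,0,1,1; 0,0,1,0; 1,1,1,0; 1,1,1,1]
def P5 : Matrix (Fin 4) (Fin 4) ℝ := !![-1,0,0,0; 0,-1,-1,1; 0,0,0,-1; 0,0,-1,0]
def Q5 : Matrix (Fin 4) (Fin 4) ℝ := !![2,-1,1,0; -1,1,-1,0; -1,1,0,0; 2,-2,1,1]
def R5 : Matrix (Fin 4) (Fin 4) ℝ := !![1,1,0,0; 1,1,1,0; 0,-1,1,0; 0,1,1,1]

theorem petrie_MA5 : petrie 5 (alphaK 5) = MA5 := by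
  ext i j
  change Fin 4 at i j
  fin_cases i <;> fin_cases j <;> simp [petrie, alphaK, MA5]

theorem petrie_MT5 : petrie 5 (thetaK 5) = MT5 := by
  ext i j
  change Fin 4 at i j
  fin_cases i <;> fin_cases j <;> simp [petrie, thetaK, MT5]

theorem petrie_NA5 : petrie 5 (hatK 5 (alphaK 5)) = NA5 := by
  ext i j
  change Fin 4 at i j
  fin_cases i <;> fin_cases j <;> simp [petrie, hatK, alphaK, NA5]

theorem petrie_NT5 : petrie 5 (hatK 5 (thetaK 5)) = NT5 := by
  ext i j
  change Fin 4 at i j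
  fin_cases i <;> fin_cases j <;> simp [petrie, hatK, thetaK, NT5]

theorem P5_inter : P5 * MA5 = MT5 * P5 := by
  ext i j
  fin_cases i <;> fin_cases j <;>
    simp [P5, MA5, MT5, Matrix.mul_apply, Fin.sum_univ_four]

theorem P5_unit : IsUnit P5 := by
  have h : P5 * P5 = 1 := by
    ext i j
    fin_cases i <;> fin_cases j <;>
      simp [P5, Matrix.mul_apply, Fin.sum_univ_four, Matrix.one_apply]
  exact IsUnit.of_mul_eq_one _ h

theorem Q5_inter : Q5 * NA5 = NT5 * Q5 := by
  ext i j
  fin_cases i <;> fin_cases j <;>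
    simp [Q5, NA5, NT5, Matrix.mul_apply, Fin.sum_univ_four] <;> norm_num

theorem Q5_unit : IsUnit Q5 := by
  have h : Q5 * R5 = 1 := by
    ext i j
    fin_cases i <;> fin_cases j <;>
      simp [Q5, R5, Matrix.mul_apply, Fin.sum_univ_four, Matrix.one_apply] <;> norm_num
  exact IsUnit.of_mul_eq_one _ h

theorem sim5 : MatSimilar (petrie 5 (alphaK 5)) (petrie 5 (thetaK 5)) := by
  refine matSimilar_of (P := P5) P5_unit ?_
  rw [petrie_MA5, petrie_MT5]
  exact P5_inter

theorem alphaK_bd (k : ℕ) (hk : 5 ≤ k) (i : ℕ) (h1 : 1 ≤ i) (h2 : i ≤ k) :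
    1 ≤ alphaK k i ∧ alphaK k i ≤ k := by
  simp only [alphaK]
  split_ifs <;> omega

theorem thetaK_bd (k : ℕ) (hk : 5 ≤ k) (i : ℕ) (h1 : 1 ≤ i) (h2 : i ≤ k) :
    1 ≤ thetaK k i ∧ thetaK k i ≤ k := by
  simp only [thetaK]
  split_ifs <;> omega

theorem alphaK_last (k : ℕ) (hk : 5 ≤ k) : alphaK k k < k := by
  simp only [alphaK]
  split_ifs <;> omega

theorem thetaK_last (k : ℕ) (hk : 5 ≤ k) : thetaK k k < k := by
  simp only [thetaK]
  split_ifs <;> omega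

theorem right5 : RightSimilar 5 (alphaK 5) (thetaK 5) := by
  refine right_of_Q 5 (by norm_num) _ _ (alphaK_bd 5 le_rfl) (alphaK_last 5 le_rfl)
    (thetaK_bd 5 le_rfl) (thetaK_last 5 le_rfl) Q5 Q5_unit ?_ ?_ ?_
  · rw [petrie_NA5, petrie_NT5]
    exact Q5_inter
  · intro i j
    change Fin 4 at i j
    fin_cases i <;> fin_cases j <;> simp [Q5]
  · intro j
    change Fin 4 at j
    change ∑ i : Fin 4, _ = _
    rw [Fin.sum_univ_four]
    fin_cases j <;> simp [Q5, alphaK, thetaK] <;> norm_num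


/-- Theorem 12. -/
theorem alphaK_thetaK_right_similar (k : ℕ) (hk : 5 ≤ k) :
    RightSimilar k (alphaK k) (thetaK k) ∧
    ¬ LeftSimilar k (alphaK k) (thetaK k) ∧
    ¬ TwoSidedSimilar k (alphaK k) (thetaK k) ∧
    (k = 5 → MatSimilar (petrie k (alphaK k)) (petrie k (thetaK k))) ∧
    (5 < k → ¬ MatSimilar (petrie k (alphaK k)) (petrie k (thetaK k))) := by
  refine ⟨?_, not_left k hk, not_two k hk, ?_, not_sim k⟩
  · rcases Nat.lt_or_ge 5 k with h | h
    · exact right_of_Q k (by omega) _ _ (alphaK_bd k hk) (alphaK_last k hk)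
        (thetaK_bd k hk) (thetaK_last k hk) (QQ k) (QQ_unit k h) (QQ_inter k h)
        (QQ_last k h) (QQ_b k h)
    · obtain rfl : k = 5 := by omega
      exact right5
  · rintro rfl
    exact sim5
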